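/- arXiv:2112.01910 — 2 statements merged into one kernel-verified Lean document; each statement's English description precedes it below -/
import Mathlib

section
/- Let G be a d-regular graph with d ≥ 3. Then γ⃗_LD(G) ≤ α'(G), where α'(G) is the maximum size of a matching in G. -/
open SimpleGraph

/-- `S` is a locating-dominating set of the undirected graph `G`. -/
def IsLDSet {V : Type*} (G : SimpleGraph V) (S : Set V) : Prop :=
  (∀ u ∉ S, (G.neighborSet u ∩ S).Nonempty) ∧
    ∀ u ∉ S, ∀ v ∉ S, u ≠ v → G.neighborSet u ∩ S ≠ G.neighborSet v ∩ S

/-- The location-domination number of the undirected graph `G`. -/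
noncomputable def gammaLD {V : Type*} (G : SimpleGraph V) : ℕ :=
  sInf {n | ∃ S : Set V, IsLDSet G S ∧ S.ncard = n}

/-- `D` is an orientation of `G`: every arc of `D` is an edge of `G`, and every
edge of `G` is given exactly one of its two possible directions. -/
def IsOrientation {V : Type*} (G : SimpleGraph V) (D : V → V → Prop) : Prop :=
  (∀ u v, D u v → G.Adj u v) ∧ ∀ u v, G.Adj u v → (D u v ↔ ¬ D v u)

/-- `S` is a locating-dominating set of the directed graph `D`
(arcs given as a relation: `D w u` means there is an arc from `w` to `u`). -/
def IsDirLDSet {V : Type*} (D : V → V → Prop) (S : Set V) : Prop :=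
  (∀ u ∉ S, ({w | D w u} ∩ S).Nonempty) ∧
    ∀ u ∉ S, ∀ v ∉ S, u ≠ v → {w | D w u} ∩ S ≠ {w | D w v} ∩ S

/-- The location-domination number of a directed graph. -/
noncomputable def gammaLDdir {V : Type*} (D : V → V → Prop) : ℕ :=
  sInf {n | ∃ S : Set V, IsDirLDSet D S ∧ S.ncard = n}

/-- The lower directed location-domination number of `G`:
minimum of `gammaLDdir D` over all orientations `D` of `G`. -/
noncomputable def lowerDirLD {V : Type*} (G : SimpleGraph V) : ℕ :=
  sInf {n | ∃ D : V → V → Prop, IsOrientation G D ∧ gammaLDdir D = n}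

/-- The upper directed location-domination number of `G`:
maximum of `gammaLDdir D` over all orientations `D` of `G`. -/
noncomputable def upperDirLD {V : Type*} (G : SimpleGraph V) : ℕ :=
  sSup {n | ∃ D : V → V → Prop, IsOrientation G D ∧ gammaLDdir D = n}

/-- The matching number `α'(G)`: maximum size of a set of pairwise
vertex-disjoint edges of `G`. -/
noncomputable def matchingNumber {V : Type*} (G : SimpleGraph V) : ℕ :=
  sSup {k | ∃ M : Set (Sym2 V), M ⊆ G.edgeSet ∧
    (M.Pairwise fun e f => ∀ v, ¬ (v ∈ e ∧ v ∈ f)) ∧ M.ncard = k}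

/-- Prescribing distinct nonempty sets of in-neighbours in `S` for the vertices outside `S`
bounds the lower directed location-domination number by the size of `S`. -/
theorem lowerDirLD_le_ncard {V : Type*} [Fintype V] (G : SimpleGraph V) (S : Set V)
    (X : V → Set V) (hX : ∀ u ∉ S, X u ⊆ G.neighborSet u ∩ S)
    (hne : ∀ u ∉ S, (X u).Nonempty)
    (hinj : ∀ u ∉ S, ∀ v ∉ S, X u = X v → u = v) :
    lowerDirLD G ≤ S.ncard := by
  classical
  let g := Fintype.equivFin V
  let D : V → V → Prop := fun u v => G.Adj u v ∧
    if u ∈ S then (if v ∈ S then g u < g v else u ∈ X v)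
    else (if v ∈ S then v ∉ X u else g u < g v)
  have hD : IsOrientation G D := by
    refine ⟨fun u v h => h.1, fun u v huv => ?_⟩
    have hg : g u ≠ g v := fun h => huv.ne (g.injective h)
    simp only [D, huv, huv.symm, true_and]
    by_cases hu : u ∈ S <;> by_cases hv : v ∈ S <;> simp only [hu, hv, if_true, if_false] <;>
      grind
  have hin : ∀ u ∉ S, {w | D w u} ∩ S = X u := by
    intro u hu
    ext w
    simp only [Set.mem_inter_iff, Set.mem_ofPred_eq, D]
    constructor
    · rintro ⟨⟨-, h⟩, hw⟩
      simpa [hw, hu] using h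
    · intro hw
      obtain ⟨hadj, hwS⟩ := hX u hu hw
      exact ⟨⟨G.adj_symm hadj, by simpa [hwS, hu] using hw⟩, hwS⟩
  have hS : IsDirLDSet D S := by
    refine ⟨fun u hu => ?_, fun u hu v hv huv => ?_⟩
    · rw [hin u hu]
      exact hne u hu
    · rw [hin u hu, hin v hv]
      exact fun h => huv (hinj u hu v hv h)
  exact (Nat.sInf_le ⟨D, hD, rfl⟩ : lowerDirLD G ≤ gammaLDdir D).trans
    (Nat.sInf_le ⟨S, hS, rfl⟩)

/-- In a `d`-regular graph with `d ≥ 3` one can choose, injectively, a pair of neighbours of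
each vertex. -/
theorem exists_injective_neighbor_pairs {V : Type*} [Fintype V] (G : SimpleGraph V) (d : ℕ)
    (hd : 3 ≤ d) (hreg : ∀ v : V, (G.neighborSet v).ncard = d) :
    ∃ X : V → Finset V, Function.Injective X ∧
      ∀ u, (X u).card = 2 ∧ ∀ w ∈ X u, G.Adj u w := by
  classical
  have hdeg : ∀ v, (G.neighborFinset v).card = d := fun v => by
    rw [← hreg v, ← Set.ncard_coe_finset, G.coe_neighborFinset]
  have hall : ∀ A : Finset V,
      A.card ≤ (A.biUnion fun u => (G.neighborFinset u).powersetCard 2).card := by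
    intro A
    have hcount := Finset.card_mul_le_card_mul (s := A)
      (t := A.biUnion fun u => (G.neighborFinset u).powersetCard 2)
      (fun u P => P ∈ (G.neighborFinset u).powersetCard 2) (m := d) (n := d) ?_ ?_
    · exact Nat.le_of_mul_le_mul_right hcount (by omega)
    · intro u hu
      have hsub : (G.neighborFinset u).powersetCard 2 ⊆
          Finset.bipartiteAbove (fun u P => P ∈ (G.neighborFinset u).powersetCard 2)
            (A.biUnion fun u => (G.neighborFinset u).powersetCard 2) u := fun P hP =>
        Finset.mem_filter.2 ⟨Finset.mem_biUnion.2 ⟨u, hu, hP⟩, hP⟩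
      refine le_trans ?_ (Finset.card_le_card hsub)
      rw [Finset.card_powersetCard, hdeg, Nat.choose_two_right, Nat.le_div_iff_mul_le two_pos]
      exact Nat.mul_le_mul_left d (by omega)
    · intro P hP
      obtain ⟨u, -, hP⟩ := Finset.mem_biUnion.1 hP
      obtain ⟨w, hw⟩ : P.Nonempty := by
        rw [← Finset.card_pos, (Finset.mem_powersetCard.1 hP).2]
        exact two_pos
      rw [← hdeg w]
      refine Finset.card_le_card fun v hv => ?_
      have hv' := (Finset.mem_powersetCard.1 (Finset.mem_filter.1 hv).2).1 hw
      rw [mem_neighborFinset] at hv' ⊢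
      exact hv'.symm
  obtain ⟨X, hinj, hX⟩ :=
    (Finset.all_card_le_biUnion_card_iff_exists_injective _).1 hall
  refine ⟨X, hinj, fun u => ?_⟩
  obtain ⟨hsub, hcard⟩ := Finset.mem_powersetCard.1 (hX u)
  exact ⟨hcard, fun w hw => (G.mem_neighborFinset u w).1 (hsub hw)⟩

/-- An involution moving vertices only along edges encodes a matching; a transversal of its
nontrivial orbits is no larger than the matching number. -/
theorem ncard_le_matchingNumber {V : Type*} [Fintype V] (G : SimpleGraph V) (f : V → V)
    (hf : Function.Involutive f) (hadj : ∀ v, f v ≠ v → G.Adj v (f v)) (S : Set V)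
    (hS : ∀ v ∈ S, f v ≠ v ∧ f v ∉ S) :
    S.ncard ≤ matchingNumber G := by
  classical
  refine le_csSup ⟨(Set.univ : Set (Sym2 V)).ncard, ?_⟩
    ⟨(fun v => s(v, f v)) '' S, ?_, ?_, ?_⟩
  · rintro k ⟨M, -, -, rfl⟩
    exact Set.ncard_le_ncard (Set.subset_univ M)
  · rintro _ ⟨v, hv, rfl⟩
    exact hadj v (hS v hv).1
  · rintro _ ⟨v, hv, rfl⟩ _ ⟨w, hw, rfl⟩ hne x ⟨hxv, hxw⟩
    apply hne
    simp only [Sym2.mem_iff] at hxv hxw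
    simp only [Sym2.eq_iff]
    have := hf v
    have := hf w
    grind
  · refine Set.InjOn.ncard_image fun v hv w hw h => ?_
    simp only [Sym2.eq_iff] at h
    have := hS v hv
    have := hS w hw
    grind

/-- The structure of a maximum matching around its uncovered vertices: no two of them are
adjacent, and the two ends of a matching edge have no distinct uncovered neighbours. -/
theorem exists_maximal_matching_involution {V : Type*} [Fintype V] (G : SimpleGraph V) :
    ∃ f : V → V, Function.Involutive f ∧ (∀ v, f v ≠ v → G.Adj v (f v)) ∧
      (∀ x y, f x = x → f y = y → ¬ G.Adj x y) ∧
      ∀ a x y, f a ≠ a → f x = x → f y = y → G.Adj a x → G.Adj (f a) y → x = y := by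
  classical
  obtain ⟨f, ⟨hf, hadj⟩, hmin⟩ := Set.exists_min_image
    {f : V → V | Function.Involutive f ∧ ∀ v, f v ≠ v → G.Adj v (f v)}
    (fun f => {v | f v = v}.ncard) (Set.toFinite _) ⟨id, fun _ => rfl, fun _ h => (h rfl).elim⟩
  have key : ∀ f' : V → V, Function.Involutive f' → (∀ v, f' v ≠ v → G.Adj v (f' v)) →
      (∀ v, f' v = v → f v = v) → ∀ x, f x = x → f' x = x := by
    intro f' hf' hadj' hsub x hx
    by_contra hx'
    have hlt : {v | f' v = v}.ncard < {v | f v = v}.ncard :=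
      Set.ncard_lt_ncard ⟨hsub, fun h => hx' (h hx)⟩
    exact absurd (hmin f' ⟨hf', hadj'⟩) (not_le.2 hlt)
  refine ⟨f, hf, hadj, fun x y hx hy hxy => ?_, fun a x y ha hx hy hax hby => ?_⟩
  · have hne := hxy.ne
    have hyx := hxy.symm
    have := key (fun v => if v = x then y else if v = y then x else f v)
      (fun v => by have := hf v; grind) (fun v => by have := hadj v; grind)
      (fun v => by grind) x hx
    grind
  · by_contra hne
    have hxa := hax.symm
    have hyb := hby.symm
    have hfa := hf a
    have := key (fun v => if v = a then x else if v = x then a else if v = f a then y else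
        if v = y then f a else f v)
      (fun v => by have := hf v; grind) (fun v => by have := hadj v; grind)
      (fun v => by grind) x hx
    grind

/-- if `G` is `d`-regular with `d ≥ 3`, then
`γ⃗_LD(G) ≤ α'(G)`. -/
theorem stmt13 {V : Type*} [Fintype V] (G : SimpleGraph V) (d : ℕ)
    (hd : 3 ≤ d) (hreg : ∀ v : V, (G.neighborSet v).ncard = d) :
    lowerDirLD G ≤ matchingNumber G := by
  classical
  obtain ⟨f, hf, hadj, hind, haug⟩ := exists_maximal_matching_involution G
  obtain ⟨Y, hYinj, hY⟩ := exists_injective_neighbor_pairs G d hd hreg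
  let g := Fintype.equivFin V
  let P : V → Prop := fun v => ∃ x, f x = x ∧ G.Adj v x
  let S : Set V := {v | f v ≠ v ∧ ((P v ∧ ¬ P (f v)) ∨ ((P v ↔ P (f v)) ∧ g v < g (f v)))}
  have hS : ∀ v ∈ S, f v ≠ v ∧ f v ∉ S := by
    rintro v ⟨hv, h⟩
    refine ⟨hv, fun ⟨_, h'⟩ => ?_⟩
    rw [hf v] at h'
    rcases h with h | h <;> rcases h' with h' | h'
    · exact h.2 h'.1
    · exact h.2 (h'.1.2 h.1)
    · exact h'.2 (h.1.2 h'.1)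
    · exact lt_asymm h.2 h'.2
  have hSc : ∀ v ∉ S, f v ≠ v → f v ∈ S ∧ (P v → P (f v)) := by
    intro v hv hfv
    simp only [S, Set.mem_ofPred_eq, hf v] at hv ⊢
    have hfv' := hfv.symm
    by_cases h1 : P v <;> by_cases h2 : P (f v) <;> simp_all <;>
      exact lt_of_le_of_ne hv fun h => hfv (g.injective h)
  have hcover : ∀ u v, f u = u → G.Adj u v → v ∉ S →
      f v ∈ S ∧ G.Adj u (f v) ∧ ∀ y, f y = y → G.Adj (f v) y → y = u := by
    intro u v hu huv hv
    have hfv : f v ≠ v := fun h => hind u v hu h huv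
    obtain ⟨hfS, hP⟩ := hSc v hv hfv
    have huniq : ∀ y, f y = y → G.Adj (f v) y → y = u := fun y hy h =>
      (haug v u y hfv hu hy huv.symm h).symm
    obtain ⟨y, hy, hvy⟩ := hP ⟨u, hu, huv.symm⟩
    obtain rfl := huniq y hy hvy
    exact ⟨hfS, hvy.symm, huniq⟩
  let T : V → Prop := fun u => ∃ a ∈ S, G.Adj u a ∧ ∀ y, f y = y → G.Adj a y → y = u
  have hT : ∀ u, f u = u → ¬ T u → ∀ v, G.Adj u v → v ∈ S := by
    intro u hu hTu v huv
    by_contra hv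
    obtain ⟨h1, h2, h3⟩ := hcover u v hu huv hv
    exact hTu ⟨f v, h1, h2, h3⟩
  let X : V → Set V := fun u =>
    if f u = u then (if T u then G.neighborSet u ∩ S else ↑(Y u)) else {f u}
  have hcard : ∀ u, f u = u → 2 ≤ (X u).ncard := by
    intro u hu
    by_cases hTu : T u
    · have hsub : G.neighborSet u ⊆
          (G.neighborSet u ∩ S) ∪ f '' (G.neighborSet u ∩ S) := by
        intro v huv
        by_cases hv : v ∈ S
        · exact Or.inl ⟨huv, hv⟩
        · obtain ⟨h1, h2, -⟩ := hcover u v hu huv hv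
          exact Or.inr ⟨f v, ⟨h2, h1⟩, hf v⟩
      have h1 := Set.ncard_le_ncard hsub
      have h2 := Set.ncard_union_le (G.neighborSet u ∩ S) (f '' (G.neighborSet u ∩ S))
      have h3 := Set.ncard_image_le (f := f) (Set.toFinite (G.neighborSet u ∩ S))
      rw [hreg] at h1
      simp only [X, hu, hTu, if_true]
      omega
    · simp only [X, hu, hTu, if_true, if_false, Set.ncard_coe_finset, (hY u).1, le_refl]
  have hXsub : ∀ u ∉ S, X u ⊆ G.neighborSet u ∩ S := by
    intro u huS w hw
    by_cases hu : f u = u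
    · by_cases hTu : T u
      · simpa only [X, hu, hTu, if_true] using hw
      · simp only [X, hu, hTu, if_true, if_false] at hw
        have huw := (hY u).2 w hw
        exact ⟨huw, hT u hu hTu w huw⟩
    · simp only [X, hu, if_false, Set.mem_singleton_iff] at hw
      subst hw
      exact ⟨hadj u hu, (hSc u huS hu).1⟩
  have hsep : ∀ u v, u ∉ S → v ∉ S → f u = u → f v = v → T u → X u = X v → u = v := by
    rintro u v - hvS hu hv hTu h
    obtain ⟨a, haS, hua, huniq⟩ := id hTu
    have ha : a ∈ X u := by
      simp only [X, hu, hTu, if_true]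
      exact ⟨hua, haS⟩
    rw [h] at ha
    exact (huniq v hv (hXsub v hvS ha).1.symm).symm
  have hsingle : ∀ u, f u ≠ u → X u = {f u} := fun u hu => by simp only [X, hu, if_false]
  refine (lowerDirLD_le_ncard G S X hXsub (fun u _ => ?_) fun u huS v hvS h => ?_).trans
    (ncard_le_matchingNumber G f hf hadj S hS)
  · by_cases hu : f u = u
    · exact Set.nonempty_of_ncard_ne_zero (by have := hcard u hu; omega)
    · rw [hsingle u hu]
      exact Set.singleton_nonempty _
  · by_cases hu : f u = u <;> by_cases hv : f v = v
    · by_cases hTu : T u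
      · exact hsep u v huS hvS hu hv hTu h
      · by_cases hTv : T v
        · exact (hsep v u hvS huS hv hu hTv h.symm).symm
        · simp only [X, hu, hv, hTu, hTv, if_true, if_false] at h
          exact hYinj (Finset.coe_injective h)
    · have := hcard u hu
      rw [h, hsingle v hv, Set.ncard_singleton] at this
      omega
    · have := hcard v hv
      rw [← h, hsingle u hu, Set.ncard_singleton] at this
      omega
    · rw [hsingle u hu, hsingle v hv, Set.singleton_eq_singleton_iff] at h
      exact hf.injective h
end

section
/- Let G be a graph of order n containing no cycle of length 4 as a (not necessarily induced) subgraph. Then γ_LD(G) ≤ Γ⃗_LD(G) ≤ n − α'(G), where α'(G) is the maximum size of a matching in G. -/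
open SimpleGraph

/-- `G` contains no cycle of length 4 as a (not necessarily induced) subgraph. -/
def C4Free {V : Type*} (G : SimpleGraph V) : Prop :=
  ¬ ∃ a b c d : V, a ≠ b ∧ a ≠ c ∧ a ≠ d ∧ b ≠ c ∧ b ≠ d ∧ c ≠ d ∧
      G.Adj a b ∧ G.Adj b c ∧ G.Adj c d ∧ G.Adj d a

/-- The location-domination number of a digraph is attained. -/
lemma exists_isDirLDSet_ncard_eq {V : Type*} (D : V → V → Prop) :
    ∃ S : Set V, IsDirLDSet D S ∧ S.ncard = gammaLDdir D :=
  Nat.sInf_mem (s := {n | ∃ S : Set V, IsDirLDSet D S ∧ S.ncard = n})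
    ⟨_, Set.univ, ⟨fun u hu => absurd (Set.mem_univ u) hu,
      fun u hu => absurd (Set.mem_univ u) hu⟩, rfl⟩

lemma gammaLDdir_le_ncard {V : Type*} {D : V → V → Prop} {S : Set V} (hS : IsDirLDSet D S) :
    gammaLDdir D ≤ S.ncard :=
  Nat.sInf_le ⟨S, hS, rfl⟩

/-- Every graph has an orientation. -/
lemma exists_isOrientation {V : Type*} (G : SimpleGraph V) :
    ∃ D : V → V → Prop, IsOrientation G D := by
  classical
  let _ : LinearOrder V := linearOrderOfSTO WellOrderingRel
  refine ⟨fun u v => G.Adj u v ∧ u < v, fun u v huv => huv.1, fun u v huv => ?_⟩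
  simp only [huv, huv.symm, true_and, not_lt]
  exact ⟨le_of_lt, fun hle => lt_of_le_of_ne hle huv.ne⟩

/-- In a `C₄`-free graph, two distinct vertices have at most one common neighbour. -/
lemma C4Free.eq_of_common_neighbors {V : Type*} {G : SimpleGraph V} (h : C4Free G)
    {u v x y : V} (huv : u ≠ v) (hux : G.Adj u x) (hvx : G.Adj v x)
    (huy : G.Adj u y) (hvy : G.Adj v y) : x = y := by
  by_contra hxy
  exact h ⟨u, x, v, y, hux.ne, huv, huy.ne, hvx.ne.symm, hxy, hvy.ne,
    hux, hvx.symm, hvy, huy.symm⟩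

/-- In a `C₄`-free graph, a locating-dominating set of an orientation is also one of the graph. -/
lemma IsDirLDSet.isLDSet {V : Type*} {G : SimpleGraph V} (h : C4Free G)
    {D : V → V → Prop} (hD : IsOrientation G D) {S : Set V} (hS : IsDirLDSet D S) :
    IsLDSet G S := by
  refine ⟨fun u hu => ?_, fun u hu v hv huv heq => hS.2 u hu v hv huv ?_⟩
  · obtain ⟨w, hw, hwS⟩ := hS.1 u hu
    exact ⟨w, (hD.1 _ _ hw).symm, hwS⟩
  · have common {a b w : V} (hab : G.neighborSet a ∩ S = G.neighborSet b ∩ S)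
        (hw : D w a) (hwS : w ∈ S) : G.Adj b w :=
      (hab ▸ (⟨(hD.1 _ _ hw).symm, hwS⟩ : w ∈ G.neighborSet a ∩ S) :
        w ∈ G.neighborSet b ∩ S).1
    obtain ⟨x, hx, hxS⟩ := hS.1 u hu
    obtain ⟨y, hy, hyS⟩ := hS.1 v hv
    have unique {w z : V} (hwu : D w u) (hwS : w ∈ S) (hzv : D z v) (hzS : z ∈ S) : w = z :=
      h.eq_of_common_neighbors huv (hD.1 _ _ hwu).symm (common heq hwu hwS)
        (common heq.symm hzv hzS) (hD.1 _ _ hzv).symm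
    ext w
    constructor
    · rintro ⟨hw, hwS⟩
      exact ⟨unique hw hwS hy hyS ▸ hy, hwS⟩
    · rintro ⟨hw, hwS⟩
      exact ⟨unique hx hxS hw hwS ▸ hx, hwS⟩

lemma gammaLD_le_gammaLDdir {V : Type*} {G : SimpleGraph V} (h : C4Free G)
    {D : V → V → Prop} (hD : IsOrientation G D) : gammaLD G ≤ gammaLDdir D := by
  obtain ⟨S, hS, hcard⟩ := exists_isDirLDSet_ncard_eq D
  exact Nat.sInf_le ⟨S, hS.isLDSet h hD, hcard⟩

lemma exists_maximum_matching {V : Type*} [Finite V] (G : SimpleGraph V) :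
    ∃ M : Set (Sym2 V), M ⊆ G.edgeSet ∧
      (M.Pairwise fun e f => ∀ v, ¬ (v ∈ e ∧ v ∈ f)) ∧ M.ncard = matchingNumber G := by
  refine Nat.sSup_mem (s := {k | ∃ M : Set (Sym2 V), M ⊆ G.edgeSet ∧
    (M.Pairwise fun e f => ∀ v, ¬ (v ∈ e ∧ v ∈ f)) ∧ M.ncard = k})
    ⟨_, ∅, Set.empty_subset _, Set.pairwise_empty _, rfl⟩ ⟨Nat.card (Sym2 V), ?_⟩
  rintro _ ⟨M, -, -, rfl⟩
  exact Set.ncard_le_card M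

/-- In an oriented `C₄`-free graph, the complement of the heads of the arcs of a matching is a
locating-dominating set. -/
lemma gammaLDdir_le_card_sub_ncard {V : Type*} [Fintype V] {G : SimpleGraph V} (h : C4Free G)
    {D : V → V → Prop} (hD : IsOrientation G D) {M : Set (Sym2 V)} (hM : M ⊆ G.edgeSet)
    (hdisj : M.Pairwise fun e f => ∀ v, ¬ (v ∈ e ∧ v ∈ f)) :
    gammaLDdir D ≤ Fintype.card V - M.ncard := by
  have arc : ∀ e : M, ∃ t s : V, D t s ∧ e.1 = s(t, s) := by
    rintro ⟨e, he⟩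
    induction e with
    | _ a b =>
      by_cases hab : D a b
      · exact ⟨a, b, hab, rfl⟩
      · exact ⟨b, a, by_contra fun hba => hab ((hD.2 a b (hM he)).2 hba), Sym2.eq_swap⟩
  choose tail head harc hedge using arc
  have tail_mem (e : M) : tail e ∈ e.1 := by simp [hedge e]
  have head_mem (e : M) : head e ∈ e.1 := by simp [hedge e]
  have edge_eq {e f : M} {v : V} (he : v ∈ e.1) (hf : v ∈ f.1) : e = f := by
    by_contra hef
    exact hdisj e.2 f.2 (fun heq => hef (Subtype.ext heq)) v ⟨he, hf⟩
  have head_inj : Function.Injective head := fun e f hef =>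
    edge_eq (head_mem e) (hef ▸ head_mem f)
  have tail_mem_compl (e : M) : tail e ∈ (Set.range head)ᶜ := by
    rintro ⟨f, hf⟩
    obtain rfl : f = e := edge_eq (head_mem f) (hf ▸ tail_mem e)
    exact (hD.1 _ _ (harc f)).ne hf.symm
  have hS : IsDirLDSet D (Set.range head)ᶜ := by
    refine ⟨fun u hu => ?_, fun u hu v hv huv heq => ?_⟩
    · obtain ⟨e, rfl⟩ := not_not.1 hu
      exact ⟨tail e, harc e, tail_mem_compl e⟩
    · obtain ⟨e, rfl⟩ := not_not.1 hu
      obtain ⟨f, rfl⟩ := not_not.1 hv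
      have hef : D (tail e) (head f) := (heq.subset ⟨harc e, tail_mem_compl e⟩).1
      have hfe : D (tail f) (head e) := (heq.symm.subset ⟨harc f, tail_mem_compl f⟩).1
      have htail : tail e = tail f := h.eq_of_common_neighbors huv
        (hD.1 _ _ (harc e)).symm (hD.1 _ _ hef).symm (hD.1 _ _ hfe).symm (hD.1 _ _ (harc f)).symm
      exact huv (congrArg head (edge_eq (tail_mem e) (htail ▸ tail_mem f)))
  refine (gammaLDdir_le_ncard hS).trans_eq ?_
  rw [Set.ncard_compl, Nat.card_eq_fintype_card, Set.ncard_range_of_injective head_inj,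
    Nat.card_coe_set_eq]

/-- if `G` (of order `n`) has no `C₄` subgraph, then
`γ_LD(G) ≤ Γ⃗_LD(G) ≤ n - α'(G)`. -/
theorem stmt16 {V : Type*} [Fintype V] (G : SimpleGraph V) (h : C4Free G) :
    gammaLD G ≤ upperDirLD G ∧
      upperDirLD G ≤ Fintype.card V - matchingNumber G := by
  obtain ⟨D, hD⟩ := exists_isOrientation G
  obtain ⟨M, hM, hdisj, hcard⟩ := exists_maximum_matching G
  have bound : ∀ n ∈ {n | ∃ D : V → V → Prop, IsOrientation G D ∧ gammaLDdir D = n},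
      n ≤ Fintype.card V - matchingNumber G := by
    rintro _ ⟨D, hD, rfl⟩
    exact hcard ▸ gammaLDdir_le_card_sub_ncard h hD hM hdisj
  exact ⟨(gammaLD_le_gammaLDdir h hD).trans (le_csSup ⟨_, bound⟩ ⟨D, hD, rfl⟩),
    csSup_le ⟨_, D, hD, rfl⟩ bound⟩
end
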